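/- arXiv:1412.3287 — 3 statements merged into one kernel-verified Lean document; each statement's English description precedes it below -/
import Mathlib

section
/- Let A be a fanning frame, F its fundamental endomorphism, P(t) its fundamental projection, and K(t) := (1/k²)·F''(t)² = P'(t)² its Jacobi endomorphism. Then (1) K(t) commutes with P(t) for every t, so K(t) preserves the decomposition ℝ^{kn} = v(t) ⊕ h(t), where v(t) is the range and h(t) the kernel of P(t); and (2) if T is an invertible (kn)×(kn) real matrix, the Jacobi endomorphism of the fanning frame t ↦ T·A(t) is T·K(t)·T⁻¹. -/
open Matrix

noncomputable def mderiv {M N : ℕ} (A : ℝ → Matrix (Fin M) (Fin N) ℝ) :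
    ℝ → Matrix (Fin M) (Fin N) ℝ :=
  fun t => Matrix.of fun i j => deriv (fun s => A s i j) t

noncomputable def dmat {M N : ℕ} (i : ℕ) (A : ℝ → Matrix (Fin M) (Fin N) ℝ) :
    ℝ → Matrix (Fin M) (Fin N) ℝ :=
  mderiv^[i] A

def MatSmooth {M N : ℕ} (A : ℝ → Matrix (Fin M) (Fin N) ℝ) : Prop :=
  ∀ i j, ContDiff ℝ (⊤ : ℕ∞) fun t => A t i j

def juxt (k n : ℕ) (B : Fin k → Matrix (Fin (k * n)) (Fin n) ℝ) :
    Matrix (Fin (k * n)) (Fin (k * n)) ℝ :=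
  Matrix.of fun r c => B (finProdFinEquiv.symm c).1 r (finProdFinEquiv.symm c).2

noncomputable def frameMat (k n : ℕ) (A : ℝ → Matrix (Fin (k * n)) (Fin n) ℝ) (t : ℝ) :
    Matrix (Fin (k * n)) (Fin (k * n)) ℝ :=
  juxt k n fun i => dmat (i : ℕ) A t

def IsFanning (k n : ℕ) (A : ℝ → Matrix (Fin (k * n)) (Fin n) ℝ) : Prop :=
  MatSmooth A ∧ ∀ t, IsUnit (frameMat k n A t)

def IsCoeffs (k n : ℕ) (A : ℝ → Matrix (Fin (k * n)) (Fin n) ℝ)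
    (P : ℕ → ℝ → Matrix (Fin n) (Fin n) ℝ) : Prop :=
  (∀ i ∈ Finset.Icc 1 k, MatSmooth (P i)) ∧
  ∀ t, dmat k A t + ∑ i ∈ Finset.Icc 1 k, (k.choose i : ℝ) • (dmat (k - i) A t * P i t) = 0

noncomputable def Nmat (k n : ℕ) : Matrix (Fin (k * n)) (Fin (k * n)) ℝ :=
  Matrix.of fun r c =>
    if ((finProdFinEquiv.symm c).1 : ℕ) = ((finProdFinEquiv.symm r).1 : ℕ) + 1 ∧
        (finProdFinEquiv.symm c).2 = (finProdFinEquiv.symm r).2 then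
      (((finProdFinEquiv.symm r).1 : ℕ) + 1 : ℝ)
    else 0

noncomputable def fundEnd (k n : ℕ) (A : ℝ → Matrix (Fin (k * n)) (Fin n) ℝ) (t : ℝ) :
    Matrix (Fin (k * n)) (Fin (k * n)) ℝ :=
  frameMat k n A t * Nmat k n * (frameMat k n A t)⁻¹

noncomputable def fundRefl (k n : ℕ) (A : ℝ → Matrix (Fin (k * n)) (Fin n) ℝ) (t : ℝ) :
    Matrix (Fin (k * n)) (Fin (k * n)) ℝ :=
  (k : ℝ)⁻¹ • ((2 : ℝ) • mderiv (fundEnd k n A) t - ((k : ℝ) - 2) • (1 : Matrix (Fin (k * n)) (Fin (k * n)) ℝ))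

noncomputable def fundProj (k n : ℕ) (A : ℝ → Matrix (Fin (k * n)) (Fin n) ℝ) (t : ℝ) :
    Matrix (Fin (k * n)) (Fin (k * n)) ℝ :=
  (2 : ℝ)⁻¹ • ((1 : Matrix (Fin (k * n)) (Fin (k * n)) ℝ) - fundRefl k n A t)

noncomputable def horDer (k n : ℕ) (A : ℝ → Matrix (Fin (k * n)) (Fin n) ℝ)
    (P : ℕ → ℝ → Matrix (Fin n) (Fin n) ℝ) (t : ℝ) : Matrix (Fin (k * n)) (Fin n) ℝ :=
  dmat (k - 1) A t + ∑ i ∈ Finset.Icc 1 (k - 1), ((k - 1).choose i : ℝ) • (dmat (k - 1 - i) A t * P i t)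

noncomputable def jacobiEnd (k n : ℕ) (A : ℝ → Matrix (Fin (k * n)) (Fin n) ℝ) (t : ℝ) :
    Matrix (Fin (k * n)) (Fin (k * n)) ℝ :=
  (((k : ℝ)) ^ 2)⁻¹ • (mderiv (mderiv (fundEnd k n A)) t * mderiv (mderiv (fundEnd k n A)) t)

lemma MatSmooth.hasDerivAt {M N : ℕ} {A : ℝ → Matrix (Fin M) (Fin N) ℝ} (hA : MatSmooth A)
    (t : ℝ) (i : Fin M) (j : Fin N) : HasDerivAt (fun s => A s i j) (mderiv A t i j) t :=
  ((hA i j).differentiable (by simp) t).hasDerivAt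

lemma matSmooth_const {M N : ℕ} (C : Matrix (Fin M) (Fin N) ℝ) : MatSmooth fun _ => C :=
  fun _ _ => contDiff_const

lemma mderiv_const {M N : ℕ} (C : Matrix (Fin M) (Fin N) ℝ) (t : ℝ) :
    mderiv (fun _ => C) t = 0 := by
  ext i j
  simp [mderiv]

lemma MatSmooth.mderiv {M N : ℕ} {A : ℝ → Matrix (Fin M) (Fin N) ℝ} (hA : MatSmooth A) :
    MatSmooth (mderiv A) := by
  intro i j
  have h := hA i j
  rw [contDiff_infty_iff_deriv] at h
  exact h.2

lemma MatSmooth.dmat {M N : ℕ} {A : ℝ → Matrix (Fin M) (Fin N) ℝ} (hA : MatSmooth A) (i : ℕ) :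
    MatSmooth (dmat i A) := by
  induction i with
  | zero => exact hA
  | succ i ih =>
    rw [_root_.dmat, Function.iterate_succ_apply']
    exact ih.mderiv

lemma mderiv_dmat {M N : ℕ} (A : ℝ → Matrix (Fin M) (Fin N) ℝ) (i : ℕ) :
    mderiv (dmat i A) = dmat (i + 1) A :=
  (Function.iterate_succ_apply' _ _ _).symm

lemma MatSmooth.mul {L M N : ℕ} {A : ℝ → Matrix (Fin L) (Fin M) ℝ}
    {B : ℝ → Matrix (Fin M) (Fin N) ℝ} (hA : MatSmooth A) (hB : MatSmooth B) :
    MatSmooth fun t => A t * B t := by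
  intro i j
  simp only [Matrix.mul_apply]
  exact ContDiff.sum fun l _ => (hA i l).mul (hB l j)

lemma mderiv_mul {L M N : ℕ} {A : ℝ → Matrix (Fin L) (Fin M) ℝ}
    {B : ℝ → Matrix (Fin M) (Fin N) ℝ} (hA : MatSmooth A) (hB : MatSmooth B) (t : ℝ) :
    mderiv (fun t => A t * B t) t = mderiv A t * B t + A t * mderiv B t := by
  ext i j
  have h := HasDerivAt.fun_sum (u := Finset.univ)
    fun l _ => (hA.hasDerivAt t i l).mul (hB.hasDerivAt t l j)
  simp only [mderiv, of_apply, Matrix.mul_apply, Matrix.add_apply, ← Finset.sum_add_distrib]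
  exact h.deriv

lemma mderiv_const_mul {L M N : ℕ} (T : Matrix (Fin L) (Fin M) ℝ)
    {B : ℝ → Matrix (Fin M) (Fin N) ℝ} (hB : MatSmooth B) (t : ℝ) :
    mderiv (fun t => T * B t) t = T * mderiv B t := by
  rw [mderiv_mul (matSmooth_const T) hB, mderiv_const, Matrix.zero_mul, zero_add]

lemma mderiv_mul_const {L M N : ℕ} {A : ℝ → Matrix (Fin L) (Fin M) ℝ} (hA : MatSmooth A)
    (T : Matrix (Fin M) (Fin N) ℝ) (t : ℝ) :
    mderiv (fun t => A t * T) t = mderiv A t * T := by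
  rw [mderiv_mul hA (matSmooth_const T), mderiv_const, Matrix.mul_zero, add_zero]

lemma mderiv_const_smul {M N : ℕ} (c : ℝ) {A : ℝ → Matrix (Fin M) (Fin N) ℝ} (hA : MatSmooth A)
    (t : ℝ) : mderiv (fun t => c • A t) t = c • mderiv A t := by
  ext i j
  exact ((hA.hasDerivAt t i j).const_mul c).deriv

lemma dmat_const_mul {L M N : ℕ} (T : Matrix (Fin L) (Fin M) ℝ)
    {A : ℝ → Matrix (Fin M) (Fin N) ℝ} (hA : MatSmooth A) (i : ℕ) :
    dmat i (fun t => T * A t) = fun t => T * dmat i A t := by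
  induction i with
  | zero => rfl
  | succ i ih =>
    funext t
    rw [← mderiv_dmat, ih, mderiv_const_mul T (hA.dmat i), mderiv_dmat]

lemma MatSmooth.contDiff_det {N : ℕ} {A : ℝ → Matrix (Fin N) (Fin N) ℝ} (hA : MatSmooth A) :
    ContDiff ℝ (⊤ : ℕ∞) fun t => (A t).det := by
  simp only [Matrix.det_apply']
  exact ContDiff.sum fun σ _ => contDiff_const.mul (contDiff_prod fun i _ => hA _ _)

lemma MatSmooth.inv {N : ℕ} {A : ℝ → Matrix (Fin N) (Fin N) ℝ} (hA : MatSmooth A)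
    (hu : ∀ t, IsUnit (A t)) : MatSmooth fun t => (A t)⁻¹ := by
  intro i j
  have hadj : ContDiff ℝ (⊤ : ℕ∞) fun t => (A t).adjugate i j := by
    simp only [Matrix.adjugate_apply]
    refine MatSmooth.contDiff_det fun a b => ?_
    by_cases h : a = j
    · subst h
      simpa only [Matrix.updateRow_self] using contDiff_const
    · simpa only [Matrix.updateRow_ne h] using hA a b
  simp only [Matrix.inv_def, Matrix.smul_apply, Ring.inverse_eq_inv', smul_eq_mul]
  exact (hA.contDiff_det.inv fun t => ((Matrix.isUnit_iff_isUnit_det _).1 (hu t)).ne_zero).mul hadj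

section Frame

variable {k n : ℕ} {A : ℝ → Matrix (Fin (k * n)) (Fin n) ℝ}

lemma mul_juxt (X : Matrix (Fin (k * n)) (Fin (k * n)) ℝ)
    (B : Fin k → Matrix (Fin (k * n)) (Fin n) ℝ) : X * juxt k n B = juxt k n fun i => X * B i := by
  ext r c
  simp [juxt, Matrix.mul_apply]

lemma juxt_inj {B C : Fin k → Matrix (Fin (k * n)) (Fin n) ℝ} (h : juxt k n B = juxt k n C) :
    B = C := by
  funext i
  ext r b
  simpa only [juxt, of_apply, Equiv.symm_apply_apply] using
    congrFun (congrFun h r) (finProdFinEquiv (i, b))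

lemma frameMat_mul_Nmat (A : ℝ → Matrix (Fin (k * n)) (Fin n) ℝ) (t : ℝ) :
    frameMat k n A t * Nmat k n = juxt k n fun i => ((i : ℕ) : ℝ) • dmat ((i : ℕ) - 1) A t := by
  ext r c
  obtain ⟨⟨i, b⟩, rfl⟩ := finProdFinEquiv.surjective c
  rw [Matrix.mul_apply, ← finProdFinEquiv.sum_comp, Fintype.sum_prod_type]
  simp only [frameMat, juxt, Nmat, of_apply, Equiv.symm_apply_apply, Matrix.smul_apply, smul_eq_mul]
  obtain ⟨i, hi⟩ := i
  cases i with
  | zero => simp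
  | succ i =>
    rw [Finset.sum_eq_single ⟨i, by omega⟩, Finset.sum_eq_single b]
    · simp [mul_comm]
    · intro b' _ hb
      simp [hb.symm]
    · simp
    · intro j _ hj
      have : i ≠ j := fun h => hj (Fin.ext h.symm)
      simp [this]
    · simp

lemma IsFanning.matSmooth_frameMat (hA : IsFanning k n A) : MatSmooth (frameMat k n A) :=
  fun i _ => hA.1.dmat _ i _

lemma IsFanning.matSmooth_fundEnd (hA : IsFanning k n A) : MatSmooth (fundEnd k n A) :=
  (hA.matSmooth_frameMat.mul (matSmooth_const _)).mul (hA.matSmooth_frameMat.inv hA.2)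

lemma IsFanning.fundEnd_mul_dmat (hA : IsFanning k n A) (t : ℝ) {i : ℕ} (hi : i < k) :
    fundEnd k n A t * dmat i A t = (i : ℝ) • dmat (i - 1) A t := by
  have h : fundEnd k n A t * frameMat k n A t = frameMat k n A t * Nmat k n := by
    rw [fundEnd, Matrix.mul_assoc,
      Matrix.nonsing_inv_mul _ ((Matrix.isUnit_iff_isUnit_det _).1 (hA.2 t)), Matrix.mul_one]
  rw [frameMat_mul_Nmat, frameMat, mul_juxt] at h
  exact congrFun (juxt_inj h) ⟨i, hi⟩

lemma IsFanning.mderiv_fundEnd_mul_dmat (hA : IsFanning k n A) (t : ℝ) {i : ℕ} (hi : i < k) :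
    mderiv (fundEnd k n A) t * dmat i A t + fundEnd k n A t * dmat (i + 1) A t =
      (i : ℝ) • dmat i A t := by
  have h : (fun s => fundEnd k n A s * dmat i A s) = fun s => (i : ℝ) • dmat (i - 1) A s :=
    funext fun s => hA.fundEnd_mul_dmat s hi
  have h' := congrArg (fun f => mderiv f t) h
  simp only [mderiv_mul hA.matSmooth_fundEnd (hA.1.dmat i),
    mderiv_const_smul _ (hA.1.dmat (i - 1)), mderiv_dmat] at h'
  rw [h']
  cases i <;> simp

lemma IsFanning.eq_zero_of_mul_dmat (hA : IsFanning k n A) (t : ℝ)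
    {X : Matrix (Fin (k * n)) (Fin (k * n)) ℝ} (hX : ∀ i < k, X * dmat i A t = 0) : X = 0 := by
  refine (hA.2 t).mul_left_eq_zero.1 ?_
  rw [frameMat, mul_juxt]
  ext r c
  simp only [juxt, of_apply, hX _ (Fin.is_lt _), Matrix.zero_apply]

lemma IsFanning.mderiv_fundEnd_add_one_mul_dmat (hA : IsFanning k n A) (t : ℝ) {i : ℕ}
    (hi : i + 1 < k) : (mderiv (fundEnd k n A) t + 1) * dmat i A t = 0 := by
  have h := hA.mderiv_fundEnd_mul_dmat t (i := i) (by omega)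
  rw [hA.fundEnd_mul_dmat t hi, Nat.add_sub_cancel] at h
  rw [Matrix.add_mul, Matrix.one_mul, eq_sub_of_add_eq h]
  push_cast
  module

lemma IsFanning.mderiv_fundEnd_add_one_mul_fundEnd (hA : IsFanning k n A) (t : ℝ) :
    (mderiv (fundEnd k n A) t + 1) * fundEnd k n A t = 0 := by
  refine hA.eq_zero_of_mul_dmat t fun i hi => ?_
  rw [Matrix.mul_assoc, hA.fundEnd_mul_dmat t hi, Matrix.mul_smul]
  cases i with
  | zero => simp
  | succ i => rw [Nat.add_sub_cancel, hA.mderiv_fundEnd_add_one_mul_dmat t hi, smul_zero]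

lemma IsFanning.mderiv_fundEnd_quadratic (hA : IsFanning k n A) (t : ℝ) :
    (mderiv (fundEnd k n A) t + 1) *
      (mderiv (fundEnd k n A) t - ((k : ℝ) - 1) • (1 : Matrix (Fin (k * n)) (Fin (k * n)) ℝ)) =
      0 := by
  refine hA.eq_zero_of_mul_dmat t fun i hi => ?_
  rw [Matrix.mul_assoc, Matrix.sub_mul, Matrix.smul_mul, Matrix.one_mul,
    eq_sub_of_add_eq (hA.mderiv_fundEnd_mul_dmat t hi), Matrix.mul_sub, Matrix.mul_sub,
    ← Matrix.mul_assoc, hA.mderiv_fundEnd_add_one_mul_fundEnd, Matrix.zero_mul, Matrix.mul_smul,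
    Matrix.mul_smul, sub_zero, ← sub_smul]
  rcases Nat.lt_or_ge (i + 1) k with h | h
  · rw [hA.mderiv_fundEnd_add_one_mul_dmat t h, smul_zero]
  · obtain rfl : k = i + 1 := by omega
    simp

lemma fundProj_eq (hk : k ≠ 0) (A : ℝ → Matrix (Fin (k * n)) (Fin n) ℝ) (t : ℝ) :
    fundProj k n A t = -(k : ℝ)⁻¹ • (mderiv (fundEnd k n A) t -
      ((k : ℝ) - 1) • (1 : Matrix (Fin (k * n)) (Fin (k * n)) ℝ)) := by
  have hk' : (k : ℝ) ≠ 0 := by exact_mod_cast hk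
  rw [fundProj, fundRefl]
  ext i j
  simp only [Matrix.smul_apply, Matrix.sub_apply, smul_eq_mul]
  field_simp
  ring

lemma IsFanning.fundProj_mul_self (hA : IsFanning k n A) (hk : k ≠ 0) (t : ℝ) :
    fundProj k n A t * fundProj k n A t = fundProj k n A t := by
  have hk' : (k : ℝ) ≠ 0 := by exact_mod_cast hk
  have h := hA.mderiv_fundEnd_quadratic t
  rw [fundProj_eq hk]
  set G := mderiv (fundEnd k n A) t - ((k : ℝ) - 1) • (1 : Matrix (Fin (k * n)) (Fin (k * n)) ℝ)
    with hG
  have hG' : mderiv (fundEnd k n A) t + 1 = G + (k : ℝ) • 1 := by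
    rw [hG]
    module
  rw [hG', add_mul, smul_mul_assoc, one_mul] at h
  rw [smul_mul_smul_comm, eq_neg_of_add_eq_zero_left h, ← smul_neg, smul_smul, smul_neg, ← neg_smul]
  congr 1
  field_simp

lemma IsFanning.matSmooth_fundProj (hA : IsFanning k n A) (hk : k ≠ 0) :
    MatSmooth (fundProj k n A) := by
  intro i j
  simp only [fundProj_eq hk, Matrix.smul_apply, Matrix.sub_apply, smul_eq_mul]
  exact contDiff_const.mul ((hA.matSmooth_fundEnd.mderiv i j).sub contDiff_const)

lemma IsFanning.mderiv_fundProj (hA : IsFanning k n A) (hk : k ≠ 0) (t : ℝ) :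
    mderiv (fundProj k n A) t = -(k : ℝ)⁻¹ • mderiv (mderiv (fundEnd k n A)) t := by
  ext i j
  have h := ((hA.matSmooth_fundEnd.mderiv.hasDerivAt t i j).sub_const
    ((((k : ℝ) - 1) • (1 : Matrix (Fin (k * n)) (Fin (k * n)) ℝ)) i j)).const_mul (-(k : ℝ)⁻¹)
  rw [funext (fundProj_eq hk A)]
  exact h.deriv

lemma IsFanning.jacobiEnd_eq (hA : IsFanning k n A) (hk : k ≠ 0) (t : ℝ) :
    jacobiEnd k n A t = mderiv (fundProj k n A) t * mderiv (fundProj k n A) t := by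
  rw [jacobiEnd, hA.mderiv_fundProj hk, smul_mul_smul_comm]
  congr 1
  ring

lemma IsFanning.jacobiEnd_commute (hA : IsFanning k n A) (hk : k ≠ 0) (t : ℝ) :
    jacobiEnd k n A t * fundProj k n A t = fundProj k n A t * jacobiEnd k n A t := by
  have hP := hA.matSmooth_fundProj hk
  have h : mderiv (fundProj k n A) t * fundProj k n A t +
      fundProj k n A t * mderiv (fundProj k n A) t = mderiv (fundProj k n A) t := by
    rw [← mderiv_mul hP hP]
    exact congrArg (fun f => mderiv f t) (funext fun s => hA.fundProj_mul_self hk s)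
  rw [hA.jacobiEnd_eq hk, mul_assoc, eq_sub_of_add_eq h, mul_sub,
    ← mul_assoc _ (fundProj k n A t), eq_sub_of_add_eq h, sub_mul, sub_sub_cancel, mul_assoc]

lemma frameMat_const_mul (T : Matrix (Fin (k * n)) (Fin (k * n)) ℝ) (hA : MatSmooth A) (t : ℝ) :
    frameMat k n (fun s => T * A s) t = T * frameMat k n A t := by
  simp only [frameMat, mul_juxt, dmat_const_mul T hA]

lemma IsFanning.const_mul (hA : IsFanning k n A) {T : Matrix (Fin (k * n)) (Fin (k * n)) ℝ}
    (hT : IsUnit T) : IsFanning k n fun t => T * A t := by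
  refine ⟨(matSmooth_const T).mul hA.1, fun t => ?_⟩
  rw [frameMat_const_mul T hA.1]
  exact hT.mul (hA.2 t)

lemma fundEnd_const_mul (T : Matrix (Fin (k * n)) (Fin (k * n)) ℝ) (hA : MatSmooth A) :
    fundEnd k n (fun s => T * A s) = fun t => T * fundEnd k n A t * T⁻¹ := by
  funext t
  simp only [fundEnd, frameMat_const_mul T hA, Matrix.mul_inv_rev, Matrix.mul_assoc]

lemma mderiv_conj {N : ℕ} (T S : Matrix (Fin N) (Fin N) ℝ) {F : ℝ → Matrix (Fin N) (Fin N) ℝ}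
    (hF : MatSmooth F) : mderiv (fun t => T * F t * S) = fun t => T * mderiv F t * S := by
  funext t
  rw [mderiv_mul_const ((matSmooth_const T).mul hF), mderiv_const_mul T hF]

lemma IsFanning.jacobiEnd_const_mul (hA : IsFanning k n A)
    {T : Matrix (Fin (k * n)) (Fin (k * n)) ℝ} (hT : IsUnit T) (t : ℝ) :
    jacobiEnd k n (fun s => T * A s) t = T * jacobiEnd k n A t * T⁻¹ := by
  have hTT : T⁻¹ * T = 1 := Matrix.nonsing_inv_mul _ ((Matrix.isUnit_iff_isUnit_det _).1 hT)
  rw [jacobiEnd, jacobiEnd, fundEnd_const_mul T hA.1, mderiv_conj _ _ hA.matSmooth_fundEnd,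
    mderiv_conj _ _ hA.matSmooth_fundEnd.mderiv, mul_smul_comm, smul_mul_assoc]
  congr 1
  simp only [mul_assoc]
  rw [← mul_assoc T⁻¹ T, hTT, one_mul]

end Frame

/-- The Jacobi endomorphism `K(t) = (1/k²) F''(t)² = P'(t)²` commutes
with the fundamental projection (hence preserves the vertical-horizontal decomposition
`ℝ^{kn} = v(t) ⊕ h(t)`), and is conjugation-equivariant under `GL(kn)`. -/
theorem stmt_10 (k n : ℕ) (hk : 2 ≤ k) (hn : 1 ≤ n)
    (A : ℝ → Matrix (Fin (k * n)) (Fin n) ℝ) (hA : IsFanning k n A) :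
    (∀ t, jacobiEnd k n A t = mderiv (fundProj k n A) t * mderiv (fundProj k n A) t) ∧
    (∀ t, jacobiEnd k n A t * fundProj k n A t = fundProj k n A t * jacobiEnd k n A t) ∧
    (∀ t, ∀ v ∈ LinearMap.range (fundProj k n A t).mulVecLin,
        (jacobiEnd k n A t).mulVec v ∈ LinearMap.range (fundProj k n A t).mulVecLin) ∧
    (∀ t, ∀ v ∈ LinearMap.ker (fundProj k n A t).mulVecLin,
        (jacobiEnd k n A t).mulVec v ∈ LinearMap.ker (fundProj k n A t).mulVecLin) ∧
    (∀ T : Matrix (Fin (k * n)) (Fin (k * n)) ℝ, IsUnit T →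
      IsFanning k n (fun t => T * A t) ∧
      ∀ t, jacobiEnd k n (fun s => T * A s) t = T * jacobiEnd k n A t * T⁻¹) := by
  have hk0 : k ≠ 0 := by omega
  refine ⟨hA.jacobiEnd_eq hk0, hA.jacobiEnd_commute hk0, fun t v hv => ?_, fun t v hv => ?_,
    fun T hT => ⟨hA.const_mul hT, hA.jacobiEnd_const_mul hT⟩⟩
  · obtain ⟨w, rfl⟩ := hv
    refine ⟨jacobiEnd k n A t *ᵥ w, ?_⟩
    simp only [Matrix.mulVecLin_apply, Matrix.mulVec_mulVec, hA.jacobiEnd_commute hk0]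
  · rw [LinearMap.mem_ker, Matrix.mulVecLin_apply] at hv ⊢
    rw [Matrix.mulVec_mulVec, ← hA.jacobiEnd_commute hk0, ← Matrix.mulVec_mulVec, hv,
      Matrix.mulVec_zero]
end

section
/- Let 𝔉 be the set of fanning k-tuples A = (A_0,…,A_{k−1}) of (kn)×n real matrices, and for A ∈ 𝔉 set F(A) := 𝐀·N·𝐀⁻¹. A map G : 𝔉 → Matrix (Fin (k*n)) (Fin (k*n)) ℝ satisfies both (i) G(A·X) = G(A) for every k-tuple X = (X_0,…,X_{k−1}) of n×n real matrices with X_0 invertible, where (A·X)_r := Σ_{i=0}^{r} C(r,i)·A_{r−i}·X_i, and (ii) G(T·A) = T·G(A)·T⁻¹ for every invertible (kn)×(kn) real matrix T, where T·A := (T·A_0,…,T·A_{k−1}), if and only if there exist real numbers a_0,…,a_{k−1} such that G(A) = Σ_{m=0}^{k−1} (a_m / m!)·F(A)^m for all A ∈ 𝔉. -/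
open Matrix

/-- The (Leibniz-rule) action of a jet `(X₀, X₁, …)` of curves of `n × n` matrices on a
`k`-tuple of `(kn) × n` matrices: `(A·X)_r = ∑_{i=0}^{r} C(r,i) A_{r-i} X_i`. -/
noncomputable def tupAct (k n : ℕ) (A : Fin k → Matrix (Fin (k * n)) (Fin n) ℝ)
    (X : ℕ → Matrix (Fin n) (Fin n) ℝ) : Fin k → Matrix (Fin (k * n)) (Fin n) ℝ :=
  fun r => ∑ i ∈ Finset.range ((r : ℕ) + 1), ((r : ℕ).choose i : ℝ) •
    (A ⟨(r : ℕ) - i, Nat.lt_of_le_of_lt (Nat.sub_le _ _) r.isLt⟩ * X i)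

/-- The matrix over a ring with `(i, i+1)` entries `i+1` and all other entries zero. -/
def weightedShift (k : ℕ) (R : Type*) [Ring R] : Matrix (Fin k) (Fin k) R :=
  Matrix.of fun i r => if (r : ℕ) = i + 1 then (((i : ℕ) + 1 : ℕ) : R) else 0

/-- The upper triangular matrix with entries `C(r, j) X_{r-j}`, through which a jet acts. -/
def jetMatrix (k : ℕ) {R : Type*} [Ring R] (X : ℕ → R) : Matrix (Fin k) (Fin k) R :=
  Matrix.of fun j r => (((r : ℕ).choose j : ℕ) : R) * X (r - j)

section Ring

variable {k : ℕ} {R : Type*} [Ring R]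

lemma weightedShift_mul_apply (B : Matrix (Fin k) (Fin k) R) (i r : Fin k) :
    (weightedShift k R * B) i r =
      if h : (i : ℕ) + 1 < k then (((i : ℕ) + 1 : ℕ) : R) * B ⟨i + 1, h⟩ r else 0 := by
  rw [Matrix.mul_apply]
  split_ifs with h
  · rw [Finset.sum_eq_single ⟨i + 1, h⟩]
    · simp [weightedShift]
    · intro j _ hj
      have : (j : ℕ) ≠ i + 1 := fun e => hj (Fin.ext e)
      simp [weightedShift, this]
    · simp
  · refine Finset.sum_eq_zero fun j _ => ?_
    have : (j : ℕ) ≠ i + 1 := by omega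
    simp [weightedShift, this]

lemma mul_weightedShift_apply_zero (B : Matrix (Fin k) (Fin k) R) (i r : Fin k)
    (hr : (r : ℕ) = 0) : (B * weightedShift k R) i r = 0 := by
  rw [Matrix.mul_apply]
  refine Finset.sum_eq_zero fun j _ => ?_
  simp [weightedShift, hr]

lemma mul_weightedShift_apply_succ (B : Matrix (Fin k) (Fin k) R) (i r s : Fin k)
    (hr : (r : ℕ) = s + 1) :
    (B * weightedShift k R) i r = (((s : ℕ) + 1 : ℕ) : R) * B i s := by
  rw [Matrix.mul_apply, Finset.sum_eq_single s]
  · simp only [weightedShift, Matrix.of_apply, hr, if_true]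
    exact (Nat.cast_commute _ _).symm.eq
  · intro j _ hj
    have : (s : ℕ) ≠ j := fun e => hj (Fin.ext e.symm)
    simp [weightedShift, hr, this]
  · simp

lemma weightedShift_pow_apply (m : ℕ) (i r : Fin k) :
    (weightedShift k R ^ m) i r =
      if (r : ℕ) = i + m then (((r : ℕ).descFactorial m : ℕ) : R) else 0 := by
  induction m generalizing i with
  | zero => simp [Matrix.one_apply, Fin.ext_iff, eq_comm]
  | succ m ih =>
    rw [pow_succ', weightedShift_mul_apply]
    split_ifs with h h' h'
    · have h2 : (r : ℕ) = i + 1 + m := by omega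
      have h3 : (r : ℕ) - m = i + 1 := by omega
      rw [ih, if_pos h2, Nat.descFactorial_succ, h3, Nat.cast_mul]
    · have h2 : ¬ (r : ℕ) = i + 1 + m := by omega
      rw [ih, if_neg h2, mul_zero]
    · omega
    · rfl

lemma weightedShift_commute_jetMatrix (X : ℕ → R) :
    Commute (weightedShift k R) (jetMatrix k X) := by
  ext i r
  rw [weightedShift_mul_apply]
  rcases Nat.eq_zero_or_pos (r : ℕ) with hr | hr
  · rw [mul_weightedShift_apply_zero _ _ _ hr]
    split_ifs <;> simp [jetMatrix, hr]
  · obtain ⟨s, hs⟩ : ∃ s : Fin k, (r : ℕ) = s + 1 := ⟨⟨r - 1, by omega⟩, by simp; omega⟩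
    rw [mul_weightedShift_apply_succ _ _ _ _ hs]
    simp only [jetMatrix, Matrix.of_apply, ← mul_assoc, ← Nat.cast_mul, hs]
    split_ifs with h
    · rw [Nat.add_sub_add_right, mul_comm ((i : ℕ) + 1), ← Nat.add_one_mul_choose_eq]
    · have : (s : ℕ) < i := by omega
      simp [Nat.choose_eq_zero_of_lt this]

lemma jetMatrix_eq_one_add_weightedShift :
    jetMatrix k (fun m => if m ≤ 1 then (1 : R) else 0) = 1 + weightedShift k R := by
  ext j r
  simp only [jetMatrix, weightedShift, Matrix.of_apply, Matrix.add_apply, Matrix.one_apply,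
    Fin.ext_iff]
  rcases lt_trichotomy (r : ℕ) j with h | h | h
  · have h1 : ¬ (j : ℕ) = r := by omega
    have h2 : ¬ (r : ℕ) = j + 1 := by omega
    simp [Nat.choose_eq_zero_of_lt h, h1, h2]
  · simp [h]
  · have h1 : ¬ (j : ℕ) = r := by omega
    by_cases h2 : (r : ℕ) = j + 1
    · simp [h2]
    · have h3 : ¬ (r : ℕ) - j ≤ 1 := by omega
      simp only [h1, h2, h3, if_false, mul_zero, add_zero]

lemma jetMatrix_single_zero (x : R) :
    jetMatrix k (fun m => if m = 0 then x else 0) = Matrix.scalar (Fin k) x := by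
  ext j r
  simp only [jetMatrix, Matrix.of_apply, Matrix.scalar_apply, Matrix.diagonal_apply, Fin.ext_iff]
  rcases lt_trichotomy (r : ℕ) j with h | h | h
  · have h1 : ¬ (j : ℕ) = r := by omega
    simp [Nat.choose_eq_zero_of_lt h, h1]
  · simp [h]
  · have h1 : ¬ (j : ℕ) = r := by omega
    have h3 : ¬ (r : ℕ) - j = 0 := by omega
    simp only [h1, h3, if_false, mul_zero]

lemma eq_jetMatrix_of_commute_weightedShift [IsAddTorsionFree R] {B : Matrix (Fin k) (Fin k) R}
    (hB : Commute (weightedShift k R) B) {a : ℕ → R} (ha : ∀ i r : Fin k, (i : ℕ) = 0 →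
      B i r = a r) : B = jetMatrix k a := by
  have key : ∀ (p : ℕ) (hp : p < k) (r : Fin k),
      B ⟨p, hp⟩ r = (((r : ℕ).choose p : ℕ) : R) * a (r - p) := by
    intro p
    induction p with
    | zero => intro hp r; simpa using ha ⟨0, hp⟩ r rfl
    | succ p ih =>
      intro hp r
      have h := congrFun (congrFun hB.eq ⟨p, by omega⟩) r
      rw [weightedShift_mul_apply, dif_pos (by exact hp)] at h
      apply nsmul_right_injective (Nat.succ_ne_zero p)
      simp only [nsmul_eq_mul, Nat.succ_eq_add_one]
      refine h.trans ?_
      rcases Nat.eq_zero_or_pos (r : ℕ) with hr | hr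
      · rw [mul_weightedShift_apply_zero _ _ _ hr]
        simp [hr]
      · obtain ⟨s, hs⟩ : ∃ s : Fin k, (r : ℕ) = s + 1 := ⟨⟨r - 1, by omega⟩, by simp; omega⟩
        rw [mul_weightedShift_apply_succ _ _ _ _ hs, ih, hs, Nat.add_sub_add_right, ← mul_assoc,
          ← mul_assoc, ← Nat.cast_mul, ← Nat.cast_mul, mul_comm (p + 1),
          ← Nat.add_one_mul_choose_eq]
  ext i r
  exact key i i.isLt r

lemma jetMatrix_algebraMap [Algebra ℝ R] (a : ℕ → ℝ) :
    jetMatrix k (fun m => algebraMap ℝ R (a m)) =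
      ∑ m ∈ Finset.range k, (a m / (m.factorial : ℝ)) • weightedShift k R ^ m := by
  ext j r
  simp only [Matrix.sum_apply, Matrix.smul_apply, weightedShift_pow_apply]
  rcases lt_or_ge (r : ℕ) j with h | h
  · rw [Finset.sum_eq_zero]
    · simp [jetMatrix, Nat.choose_eq_zero_of_lt h]
    · intro m _
      have : ¬ (r : ℕ) = j + m := by omega
      simp [this]
  · rw [Finset.sum_eq_single ((r : ℕ) - j)]
    · have h1 : (r : ℕ) = j + (r - j) := by omega
      rw [if_pos h1, Nat.descFactorial_eq_factorial_mul_choose, Nat.choose_symm h]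
      have hf : ((((r : ℕ) - j).factorial : ℕ) : ℝ) ≠ 0 := by positivity
      rw [← map_natCast (algebraMap ℝ R), Algebra.smul_def, ← map_mul]
      simp only [jetMatrix, Matrix.of_apply]
      rw [← map_natCast (algebraMap ℝ R), ← map_mul]
      congr 1
      push_cast
      field_simp
    · intro m _ hm
      have : ¬ (r : ℕ) = j + m := by omega
      simp [this]
    · intro hr
      exact absurd (Finset.mem_range.2 (by omega)) hr

end Ring

section Blocks

variable {k n : ℕ}

/-- Flattening of a `k × k` matrix of `n × n` blocks into a `(kn) × (kn)` matrix. -/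
noncomputable def blockEquiv (k n : ℕ) :
    Matrix (Fin k) (Fin k) (Matrix (Fin n) (Fin n) ℝ) ≃ₐ[ℝ]
      Matrix (Fin (k * n)) (Fin (k * n)) ℝ :=
  (Matrix.compAlgEquiv (Fin k) (Fin n) ℝ ℝ).trans
    (Matrix.reindexAlgEquiv ℝ ℝ finProdFinEquiv)

lemma blockEquiv_apply (B : Matrix (Fin k) (Fin k) (Matrix (Fin n) (Fin n) ℝ))
    (r c : Fin (k * n)) :
    blockEquiv k n B r c = B (finProdFinEquiv.symm r).1 (finProdFinEquiv.symm c).1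
      (finProdFinEquiv.symm r).2 (finProdFinEquiv.symm c).2 := rfl

lemma blockEquiv_weightedShift : blockEquiv k n (weightedShift k _) = Nmat k n := by
  ext r c
  rw [blockEquiv_apply]
  simp only [weightedShift, Nmat, Matrix.of_apply]
  generalize finProdFinEquiv.symm r = p
  generalize finProdFinEquiv.symm c = q
  by_cases h : (q.1 : ℕ) = p.1 + 1
  · rw [if_pos h, ← Matrix.diagonal_natCast, Matrix.diagonal_apply]
    simp [h, eq_comm]
  · simp [h]

lemma isUnit_blockEquiv_jetMatrix (X : ℕ → Matrix (Fin n) (Fin n) ℝ) (hX : IsUnit (X 0)) :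
    IsUnit (blockEquiv k n (jetMatrix k X)) := by
  have ht : (Matrix.comp _ _ _ _ ℝ (jetMatrix k X)).BlockTriangular Prod.fst := by
    rintro ⟨i, s⟩ ⟨j, t⟩ hij
    have : (j : ℕ) < i := hij
    simp [jetMatrix, Nat.choose_eq_zero_of_lt this]
  have hu : IsUnit (Matrix.comp _ _ _ _ ℝ (jetMatrix k X)) := by
    rw [Matrix.isUnit_iff_isUnit_det] at hX ⊢
    rw [ht.det_fintype, IsUnit.prod_univ_iff]
    intro a
    let e : Fin n ≃ {p : Fin k × Fin n // p.1 = a} :=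
      { toFun := fun s => ⟨(a, s), rfl⟩
        invFun := fun p => p.1.2
        left_inv := fun _ => rfl
        right_inv := by rintro ⟨⟨_, s⟩, rfl⟩; rfl }
    rw [← Matrix.det_submatrix_equiv_self e]
    have hblock : ((Matrix.comp _ _ _ _ ℝ (jetMatrix k X)).toSquareBlock Prod.fst a).submatrix
        e e = X 0 := by
      ext s t
      simp [e, Matrix.toSquareBlock_def, jetMatrix]
    rwa [hblock]
  exact hu.map (Matrix.reindexAlgEquiv ℝ ℝ finProdFinEquiv)

lemma juxt_mul (T : Matrix (Fin (k * n)) (Fin (k * n)) ℝ)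
    (A : Fin k → Matrix (Fin (k * n)) (Fin n) ℝ) :
    juxt k n (fun i => T * A i) = T * juxt k n A := by
  ext r c
  simp [juxt, Matrix.mul_apply]

lemma juxt_tupAct (A : Fin k → Matrix (Fin (k * n)) (Fin n) ℝ)
    (X : ℕ → Matrix (Fin n) (Fin n) ℝ) :
    juxt k n (tupAct k n A X) = juxt k n A * blockEquiv k n (jetMatrix k X) := by
  ext p c
  rw [Matrix.mul_apply, ← finProdFinEquiv.sum_comp, Fintype.sum_prod_type]
  simp only [blockEquiv_apply, juxt, Matrix.of_apply, Equiv.symm_apply_apply]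
  generalize (finProdFinEquiv.symm c).1 = r
  generalize (finProdFinEquiv.symm c).2 = t
  have h1 : ∀ j : Fin k, (∑ s, A j p s * jetMatrix k X j r s t) =
      ((r : ℕ).choose j : ℝ) * (A j * X (r - j)) p t := by
    intro j
    simp only [jetMatrix, Matrix.of_apply, Matrix.mul_apply, Finset.mul_sum, ← nsmul_eq_mul,
      Matrix.smul_apply]
    refine Finset.sum_congr rfl fun s _ => ?_
    simp only [nsmul_eq_mul]
    ring
  simp only [h1, tupAct, Matrix.sum_apply, Matrix.smul_apply, smul_eq_mul]
  rw [← Finset.sum_range_reflect]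
  have hsub : ∑ j : Fin k, ((r : ℕ).choose j : ℝ) * (A j * X (r - j)) p t =
      ∑ j ∈ Finset.range k, if h : j < k then
        ((r : ℕ).choose j : ℝ) * (A ⟨j, h⟩ * X (r - j)) p t else 0 := by
    rw [← Fin.sum_univ_eq_sum_range (fun j => if h : j < k then
        ((r : ℕ).choose j : ℝ) * (A ⟨j, h⟩ * X (r - j)) p t else 0)]
    simp
  rw [hsub, ← Finset.sum_subset (Finset.range_mono (Nat.succ_le_of_lt r.isLt))]
  · refine Finset.sum_congr rfl fun j hj => ?_
    have hj : j < r + 1 := Finset.mem_range.1 hj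
    have hjr : j ≤ r := Nat.lt_succ_iff.1 hj
    have e1 : (r : ℕ) + 1 - 1 - j = r - j := by omega
    have e2 : (r : ℕ) - (r - j) = j := by omega
    rw [dif_pos (lt_of_le_of_lt hjr r.isLt)]
    simp only [e1, e2, Nat.choose_symm hjr]
  · intro j _ hj
    have : (r : ℕ) < j := by simpa using hj
    simp [Nat.choose_eq_zero_of_lt this]

/-- The tuple of column blocks of the identity matrix. -/
def stdTuple (k n : ℕ) : Fin k → Matrix (Fin (k * n)) (Fin n) ℝ :=
  fun i => Matrix.of fun r s =>
    (1 : Matrix (Fin (k * n)) (Fin (k * n)) ℝ) r (finProdFinEquiv (i, s))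

lemma juxt_stdTuple : juxt k n (stdTuple k n) = 1 := by
  ext r c
  exact congrArg ((1 : Matrix (Fin (k * n)) (Fin (k * n)) ℝ) r)
    (finProdFinEquiv.apply_symm_apply c)

lemma juxt_mul_stdTuple (A : Fin k → Matrix (Fin (k * n)) (Fin n) ℝ) :
    (fun i => juxt k n A * stdTuple k n i) = A := by
  ext i r s
  simp only [juxt, stdTuple, Matrix.mul_apply, Matrix.of_apply, Matrix.one_apply, mul_ite, mul_one,
    mul_zero, Finset.sum_ite_eq', Finset.mem_univ, if_true,
    Equiv.symm_apply_apply]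

lemma exists_eq_jetMatrix_of_commute (B : Matrix (Fin k) (Fin k) (Matrix (Fin n) (Fin n) ℝ))
    (hB : ∀ X : ℕ → Matrix (Fin n) (Fin n) ℝ, IsUnit (X 0) → Commute (jetMatrix k X) B) :
    ∃ a : ℕ → ℝ, B = jetMatrix k fun m => algebraMap ℝ _ (a m) := by
  have hs : ∀ i j, ∃ c : ℝ, algebraMap ℝ (Matrix (Fin n) (Fin n) ℝ) c = B i j := by
    intro i j
    refine Matrix.mem_range_scalar_of_commute_transvectionStruct fun t => ?_
    have ht : IsUnit t.toMatrix := (Units.mk _ _ t.mul_inv t.inv_mul).isUnit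
    have h := hB (fun m => if m = 0 then t.toMatrix else 0) (by simpa using ht)
    rw [jetMatrix_single_zero] at h
    have h2 := congrFun (congrFun h.eq i) j
    simpa [Matrix.scalar_apply, Matrix.diagonal_mul, Matrix.mul_diagonal, commute_iff_eq] using h2
  choose c hc using hs
  have hN : Commute (weightedShift k (Matrix (Fin n) (Fin n) ℝ)) B := by
    have h := hB (fun m => if m ≤ 1 then 1 else 0) (by simp)
    rw [jetMatrix_eq_one_add_weightedShift] at h
    simpa using h.sub_left (Commute.one_left B)
  have : IsAddTorsionFree (Matrix (Fin n) (Fin n) ℝ) :=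
    inferInstanceAs (IsAddTorsionFree (Fin n → Fin n → ℝ))
  refine ⟨fun m => if h : m < k then c ⟨0, by omega⟩ ⟨m, h⟩ else 0,
    eq_jetMatrix_of_commute_weightedShift hN fun i r hi => ?_⟩
  have hi0 : i = ⟨0, by omega⟩ := Fin.ext hi
  simp [← hc, ← hi0]

lemma conj_polynomial {d : ℕ} {T F : Matrix (Fin d) (Fin d) ℝ} (hT : IsUnit T) (k : ℕ)
    (a : ℕ → ℝ) :
    ∑ m ∈ Finset.range k, a m • (T * F * T⁻¹) ^ m =
      T * (∑ m ∈ Finset.range k, a m • F ^ m) * T⁻¹ := by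
  obtain ⟨u, rfl⟩ := hT
  rw [← Matrix.coe_units_inv]
  simp only [Units.conj_pow, Finset.mul_sum, Finset.sum_mul, mul_smul_comm, smul_mul_assoc]

end Blocks

/-- A map `G` from fanning `(k-1)`-jets to `gl(kn)` is invariant under
the jet-group action and `GL(kn)`-equivariant iff it is a fixed polynomial
`∑_{m<k} (a_m/m!) F^m` in the fundamental endomorphism `F(A) = 𝐀 N 𝐀⁻¹`. -/
theorem stmt_17 (k n : ℕ) (hk : 2 ≤ k) (hn : 1 ≤ n)
    (G : (Fin k → Matrix (Fin (k * n)) (Fin n) ℝ) → Matrix (Fin (k * n)) (Fin (k * n)) ℝ) :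
    ((∀ A, IsUnit (juxt k n A) → ∀ X : ℕ → Matrix (Fin n) (Fin n) ℝ, IsUnit (X 0) →
        G (tupAct k n A X) = G A) ∧
     (∀ A, IsUnit (juxt k n A) → ∀ T : Matrix (Fin (k * n)) (Fin (k * n)) ℝ, IsUnit T →
        G (fun i => T * A i) = T * G A * T⁻¹)) ↔
    ∃ a : ℕ → ℝ, ∀ A, IsUnit (juxt k n A) →
      G A = ∑ m ∈ Finset.range k, (a m / (m.factorial : ℝ)) •
        (juxt k n A * Nmat k n * (juxt k n A)⁻¹) ^ m := by
  constructor
  · rintro ⟨hX, hT⟩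
    have h1 : IsUnit (juxt k n (stdTuple k n)) := by rw [juxt_stdTuple]; exact isUnit_one
    have hG : ∀ A, IsUnit (juxt k n A) →
        G A = juxt k n A * G (stdTuple k n) * (juxt k n A)⁻¹ := by
      intro A hA
      have h := hT _ h1 _ hA
      rwa [juxt_mul_stdTuple] at h
    obtain ⟨B, hB⟩ := (blockEquiv k n).surjective (G (stdTuple k n))
    obtain ⟨a, ha⟩ := exists_eq_jetMatrix_of_commute B (by
      intro X hX0
      have hM := isUnit_blockEquiv_jetMatrix (k := k) X hX0
      have hj : juxt k n (tupAct k n (stdTuple k n) X) = blockEquiv k n (jetMatrix k X) := by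
        rw [juxt_tupAct, juxt_stdTuple, one_mul]
      have h := hG (tupAct k n (stdTuple k n) X) (hj ▸ hM)
      rw [hX _ h1 X hX0, hj, ← hB] at h
      refine (blockEquiv k n).injective ?_
      rw [map_mul, map_mul]
      nth_rewrite 2 [h]
      rw [mul_assoc, Matrix.nonsing_inv_mul _ ((Matrix.isUnit_iff_isUnit_det _).1 hM), mul_one])
    refine ⟨a, fun A hA => ?_⟩
    rw [hG A hA, conj_polynomial hA k (fun m => a m / (m.factorial : ℝ)), ← hB, ha,
      jetMatrix_algebraMap]
    simp only [map_sum, map_smul, map_pow, blockEquiv_weightedShift]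
  · rintro ⟨a, ha⟩
    refine ⟨fun A hA X hX => ?_, fun A hA T hT => ?_⟩
    · have hM := isUnit_blockEquiv_jetMatrix (k := k) X hX
      have hj := juxt_tupAct A X
      have hc : blockEquiv k n (jetMatrix k X) * Nmat k n =
          Nmat k n * blockEquiv k n (jetMatrix k X) := by
        rw [← blockEquiv_weightedShift, ← map_mul, ← map_mul,
          (weightedShift_commute_jetMatrix X).eq]
      rw [ha _ hA, ha _ (hj ▸ hA.mul hM), hj, Matrix.mul_inv_rev, mul_assoc (juxt k n A), hc]
      simp only [mul_assoc]
      rw [← mul_assoc _ _ (juxt k n A)⁻¹,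
        Matrix.mul_nonsing_inv _ ((Matrix.isUnit_iff_isUnit_det _).1 hM), one_mul]
    · have hj := juxt_mul T A
      rw [ha _ hA, ha _ (hj ▸ hT.mul hA), hj,
        ← conj_polynomial hT k (fun m => a m / (m.factorial : ℝ)), Matrix.mul_inv_rev]
      simp only [mul_assoc]
end

section
/- A (kn)×(kn) real matrix T commutes with N (i.e. T·N = N·T) if and only if there exist n×n real matrices X_1,…,X_k such that, in block form with blocks indexed by 0 ≤ i, j ≤ k−1, the (i, j) block of T equals C(j,i)·X_{j−i+1} for i ≤ j and 0 for i > j; such a T is invertible if and only if X_1 is invertible. (This computes the isotropy group, under conjugation, of the fundamental endomorphism of the standard fanning (k−1)-jet, showing that the fundamental endomorphism is an equivariant embedding of the space of (k−1)-jets of fanning curves as an Adjoint orbit in gl(kn).) -/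
open Matrix

/-- The block form of an element of the commutant of `N`: the `(i, j)` block of `T` is
`C(j,i) • X_{j-i+1}` for `i ≤ j` and `0` for `i > j`. -/
def BinomBlockForm (k n : ℕ) (T : Matrix (Fin (k * n)) (Fin (k * n)) ℝ)
    (X : ℕ → Matrix (Fin n) (Fin n) ℝ) : Prop :=
  ∀ r c, T r c =
    if ((finProdFinEquiv.symm r).1 : ℕ) ≤ ((finProdFinEquiv.symm c).1 : ℕ) then
      (((finProdFinEquiv.symm c).1 : ℕ).choose ((finProdFinEquiv.symm r).1 : ℕ) : ℝ) *
        X (((finProdFinEquiv.symm c).1 : ℕ) - ((finProdFinEquiv.symm r).1 : ℕ) + 1)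
          (finProdFinEquiv.symm r).2 (finProdFinEquiv.symm c).2
    else 0

section

variable {k n : ℕ} (T : Matrix (Fin (k * n)) (Fin (k * n)) ℝ)

lemma Nmat_apply (i j : Fin k) (a b : Fin n) :
    Nmat k n (finProdFinEquiv (i, a)) (finProdFinEquiv (j, b)) =
      if (j : ℕ) = i + 1 ∧ b = a then (i + 1 : ℝ) else 0 := by
  simp only [Nmat, Matrix.of_apply, Equiv.symm_apply_apply]

lemma mul_Nmat_apply_zero (r : Fin (k * n)) {j : Fin k} (hj : (j : ℕ) = 0) (b : Fin n) :
    (T * Nmat k n) r (finProdFinEquiv (j, b)) = 0 := by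
  rw [Matrix.mul_apply, ← finProdFinEquiv.sum_comp]
  refine Finset.sum_eq_zero fun p _ => ?_
  rw [Nmat_apply, if_neg (by omega), mul_zero]

lemma mul_Nmat_apply_succ (r : Fin (k * n)) {j j' : Fin k} (hj : (j : ℕ) = j' + 1) (b : Fin n) :
    (T * Nmat k n) r (finProdFinEquiv (j, b)) =
      (j' + 1 : ℝ) * T r (finProdFinEquiv (j', b)) := by
  rw [Matrix.mul_apply, ← finProdFinEquiv.sum_comp, Finset.sum_eq_single (j', b)]
  · rw [Nmat_apply, if_pos ⟨hj, rfl⟩, mul_comm]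
  · rintro ⟨l, c⟩ _ hne
    rw [Nmat_apply, if_neg, mul_zero]
    rintro ⟨h, rfl⟩
    exact hne (Prod.ext (Fin.ext (by dsimp only; omega)) rfl)
  · simp

lemma Nmat_mul_apply_last {i : Fin k} (hi : (i : ℕ) + 1 = k) (a : Fin n) (c : Fin (k * n)) :
    (Nmat k n * T) (finProdFinEquiv (i, a)) c = 0 := by
  rw [Matrix.mul_apply, ← finProdFinEquiv.sum_comp]
  refine Finset.sum_eq_zero fun p _ => ?_
  have := p.1.isLt
  rw [Nmat_apply, if_neg (by omega), zero_mul]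

lemma Nmat_mul_apply_succ {i i' : Fin k} (hi : (i' : ℕ) = i + 1) (a : Fin n) (c : Fin (k * n)) :
    (Nmat k n * T) (finProdFinEquiv (i, a)) c =
      (i + 1 : ℝ) * T (finProdFinEquiv (i', a)) c := by
  rw [Matrix.mul_apply, ← finProdFinEquiv.sum_comp, Finset.sum_eq_single (i', a)]
  · rw [Nmat_apply, if_pos ⟨hi, rfl⟩]
  · rintro ⟨l, b⟩ _ hne
    rw [Nmat_apply, if_neg, zero_mul]
    rintro ⟨h, rfl⟩
    exact hne (Prod.ext (Fin.ext (by dsimp only; omega)) rfl)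
  · simp

variable {T}

/-- The case distinction in `BinomBlockForm` is redundant, since `C(j,i) = 0` for `i > j`. -/
lemma binomBlockForm_iff {X : ℕ → Matrix (Fin n) (Fin n) ℝ} :
    BinomBlockForm k n T X ↔ ∀ (i j : Fin k) (a b : Fin n),
      T (finProdFinEquiv (i, a)) (finProdFinEquiv (j, b)) =
        ((j : ℕ).choose i : ℝ) * X (j - i + 1) a b := by
  have key : ∀ (i j : Fin k) (a b : Fin n),
      (if (i : ℕ) ≤ j then ((j : ℕ).choose i : ℝ) * X (j - i + 1) a b else 0) =
        ((j : ℕ).choose i : ℝ) * X (j - i + 1) a b := by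
    intro i j a b
    split_ifs with h
    · rfl
    · rw [Nat.choose_eq_zero_of_lt (not_le.mp h), Nat.cast_zero, zero_mul]
  constructor
  · intro h i j a b
    rw [← key]
    simpa only [Equiv.symm_apply_apply] using h (finProdFinEquiv (i, a)) (finProdFinEquiv (j, b))
  · intro h r c
    have := h (finProdFinEquiv.symm r).1 (finProdFinEquiv.symm c).1
      (finProdFinEquiv.symm r).2 (finProdFinEquiv.symm c).2
    rw [← key] at this
    simpa only [Prod.mk.eta, Equiv.apply_symm_apply] using this

lemma BinomBlockForm.mul_Nmat_comm {X : ℕ → Matrix (Fin n) (Fin n) ℝ}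
    (h : BinomBlockForm k n T X) : T * Nmat k n = Nmat k n * T := by
  rw [binomBlockForm_iff] at h
  ext r c
  obtain ⟨⟨i, a⟩, rfl⟩ := finProdFinEquiv.surjective r
  obtain ⟨⟨j, b⟩, rfl⟩ := finProdFinEquiv.surjective c
  have hi := i.isLt
  have hj := j.isLt
  rcases Nat.eq_zero_or_pos (j : ℕ) with hj0 | hj0
  · rw [mul_Nmat_apply_zero T _ hj0]
    rcases (Nat.succ_le_of_lt hi).eq_or_lt with hik | hik
    · rw [Nmat_mul_apply_last T hik]
    · rw [Nmat_mul_apply_succ T (i' := ⟨i + 1, hik⟩) rfl, h, hj0]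
      simp
  · obtain ⟨l, hjj⟩ : ∃ l : Fin k, (j : ℕ) = l + 1 :=
      ⟨⟨j - 1, by omega⟩, by dsimp only; omega⟩
    rw [mul_Nmat_apply_succ T _ hjj, h]
    rcases (Nat.succ_le_of_lt hi).eq_or_lt with hik | hik
    · rw [Nmat_mul_apply_last T hik, Nat.choose_eq_zero_of_lt (by omega)]
      simp
    · rw [Nmat_mul_apply_succ T (i' := ⟨i + 1, hik⟩) rfl, h, hjj]
      have := congrArg (Nat.cast (R := ℝ)) (Nat.add_one_mul_choose_eq (l : ℕ) i)
      push_cast at this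
      rw [← mul_assoc, ← mul_assoc, this, Nat.add_sub_add_right, mul_comm ((i : ℝ) + 1)]

lemma choose_mul_first_row_of_mul_Nmat_comm (h : T * Nmat k n = Nmat k n * T) (hk : 0 < k)
    (a b : Fin n) (i : ℕ) : ∀ (hi : i < k) (j : ℕ) (hj : j < k),
      T (finProdFinEquiv (⟨i, hi⟩, a)) (finProdFinEquiv (⟨j, hj⟩, b)) =
        (j.choose i : ℝ) *
          T (finProdFinEquiv (⟨0, hk⟩, a)) (finProdFinEquiv (⟨j - i, by omega⟩, b)) := by
  induction i with
  | zero => simp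
  | succ i ih =>
    intro hi j hj
    have hi0 : (i + 1 : ℝ) ≠ 0 := by positivity
    have hc := congrFun (congrFun h (finProdFinEquiv (⟨i, by omega⟩, a)))
      (finProdFinEquiv (⟨j, hj⟩, b))
    rw [Nmat_mul_apply_succ T (i' := ⟨i + 1, hi⟩) rfl] at hc
    apply mul_left_cancel₀ hi0
    refine hc.symm.trans ?_
    cases j with
    | zero => simp [mul_Nmat_apply_zero]
    | succ j =>
      rw [mul_Nmat_apply_succ T _ (j' := ⟨j, by omega⟩) rfl, ih]
      have := congrArg (Nat.cast (R := ℝ)) (Nat.add_one_mul_choose_eq j i)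
      push_cast at this
      simp only [Nat.add_sub_add_right]
      rw [← mul_assoc, ← mul_assoc, this, mul_comm ((i : ℝ) + 1)]

lemma exists_binomBlockForm_of_mul_Nmat_comm (h : T * Nmat k n = Nmat k n * T) :
    ∃ X : ℕ → Matrix (Fin n) (Fin n) ℝ, BinomBlockForm k n T X := by
  refine ⟨fun m => Matrix.of fun a b => if hm : m - 1 < k then
    T (finProdFinEquiv (⟨0, by omega⟩, a)) (finProdFinEquiv (⟨m - 1, hm⟩, b)) else 0, ?_⟩
  rw [binomBlockForm_iff]
  intro i j a b
  have hj := j.isLt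
  have hm : (j : ℕ) - i < k := by omega
  simpa [hm] using
    choose_mul_first_row_of_mul_Nmat_comm h (by omega) a b i i.isLt j j.isLt

lemma BinomBlockForm.det_eq {X : ℕ → Matrix (Fin n) (Fin n) ℝ}
    (h : BinomBlockForm k n T X) : T.det = (X 1).det ^ k := by
  rw [binomBlockForm_iff] at h
  have htri : (T.submatrix finProdFinEquiv finProdFinEquiv).BlockTriangular
      (Prod.fst : Fin k × Fin n → Fin k) := by
    rintro ⟨i, a⟩ ⟨j, b⟩ hij
    rw [Matrix.submatrix_apply, h, Nat.choose_eq_zero_of_lt hij, Nat.cast_zero, zero_mul]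
  rw [← Matrix.det_submatrix_equiv_self finProdFinEquiv T, htri.det_fintype]
  have hblock : ∀ i : Fin k, ((T.submatrix finProdFinEquiv finProdFinEquiv).toSquareBlock
      (Prod.fst : Fin k × Fin n → Fin k) i).det = (X 1).det := by
    intro i
    let e : Fin n ≃ {p : Fin k × Fin n // p.1 = i} :=
      { toFun := fun a => ⟨(i, a), rfl⟩
        invFun := fun p => p.1.2
        left_inv := fun _ => rfl
        right_inv := by rintro ⟨⟨_, a⟩, rfl⟩; rfl }
    rw [← Matrix.det_submatrix_equiv_self e]
    congr 1
    ext a b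
    simp [e, Matrix.toSquareBlock_def, h]
  simp [hblock]

end

/-- A `(kn) × (kn)` matrix commutes with `N` iff it has the upper
block-triangular binomial form determined by matrices `X₁, …, X_k`; and such a matrix is
invertible iff `X₁` is. -/
theorem stmt_18 (k n : ℕ) (hk : 2 ≤ k) (hn : 1 ≤ n)
    (T : Matrix (Fin (k * n)) (Fin (k * n)) ℝ) :
    (T * Nmat k n = Nmat k n * T ↔
      ∃ X : ℕ → Matrix (Fin n) (Fin n) ℝ, BinomBlockForm k n T X) ∧
    (∀ X : ℕ → Matrix (Fin n) (Fin n) ℝ, BinomBlockForm k n T X →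
      (IsUnit T ↔ IsUnit (X 1))) := by
  refine ⟨⟨exists_binomBlockForm_of_mul_Nmat_comm, fun ⟨_, hX⟩ => hX.mul_Nmat_comm⟩,
    fun X hX => ?_⟩
  rw [Matrix.isUnit_iff_isUnit_det, Matrix.isUnit_iff_isUnit_det, hX.det_eq,
    isUnit_pow_iff (by omega)]
end
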